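/- (Lemma 2) Let 1 ≤ m ≤ n. Let A be an m×(n−1) binary matrix with guard bits a_{i,−1} = 1 and a_{i,n−1} = 0, let B be an (m−1)×n binary matrix with guard bits b_{−1,j} = 1 and b_{m−1,j} = 0, and let X = (x_{i,j}) be an m×n binary matrix. Define Δa_{i,j} = a_{i,j−1} − a_{i,j} and Δb_{i,j} = b_{i−1,j} − b_{i,j} for 0 ≤ i ≤ m−1 and 0 ≤ j ≤ n−1, and set E_e^{mn}(A,B,X) = (1/2)·Σ_{i,j} (Δa_{i,j})^2 + (1/2)·Σ_{i,j} (Δb_{i,j})^2 + Σ_{i,j} (x_{i,j} − Δa_{i,j})^2 + Σ_{i,j} x_{i,j}·(1 − Δb_{i,j}). If A, B, and X do not satisfy at least one of the row domain-wall condition, the column domain-wall condition, the dual-permutation condition, or the one-hot permutation condition, then E_e^{mn}(A,B,X) > (m+n)/2. -/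

import Mathlib

/-- Guard-extended row of the matrix `A` (rows of length `n-1`, guard bits
`a_{i,-1} = 1` at shifted index `0` and `a_{i,n-1} = 0` at shifted index `n`). -/
def gA (n : ℕ) (A : ℕ → ℕ → ℤ) (i j : ℕ) : ℤ :=
  if j = 0 then 1 else if j < n then A i (j - 1) else 0

/-- `Δa_{i,j} = a_{i,j-1} - a_{i,j}` computed on the guard-extended rows of `A`. -/
def dA (n : ℕ) (A : ℕ → ℕ → ℤ) (i j : ℕ) : ℤ := gA n A i j - gA n A i (j + 1)

/-- Guard-extended column of the matrix `B` (columns of length `m-1`, guard bits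
`b_{-1,j} = 1` at shifted index `0` and `b_{m-1,j} = 0` at shifted index `m`). -/
def gB (m : ℕ) (B : ℕ → ℕ → ℤ) (i j : ℕ) : ℤ :=
  if i = 0 then 1 else if i < m then B (i - 1) j else 0

/-- `Δb_{i,j} = b_{i-1,j} - b_{i,j}` computed on the guard-extended columns of `B`. -/
def dB (m : ℕ) (B : ℕ → ℕ → ℤ) (i j : ℕ) : ℤ := gB m B i j - gB m B (i + 1) j

/-- Row domain-wall condition: every guard-extended row of the `m × (n-1)` matrix `A`
is a domain-wall vector. -/
def RowDW (m n : ℕ) (A : ℕ → ℕ → ℤ) : Prop :=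
  ∀ i < m, ∃ t ≤ n - 1, ∀ j < n - 1, (j < t → A i j = 1) ∧ (t ≤ j → A i j = 0)

/-- Column domain-wall condition: every guard-extended column of the `(m-1) × n` matrix `B`
is a domain-wall vector. -/
def ColDW (m n : ℕ) (B : ℕ → ℕ → ℤ) : Prop :=
  ∀ j < n, ∃ t ≤ m - 1, ∀ i < m - 1, (i < t → B i j = 1) ∧ (t ≤ i → B i j = 0)

/-- The extended dual-matrix domain-wall QUBO energy for partial permutations:
`E_eᵐⁿ(A,B,X) = ½ ΣΣ (Δa)² + ½ ΣΣ (Δb)² + ΣΣ (x - Δa)² + ΣΣ x·(1 - Δb)`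
over `0 ≤ i ≤ m-1` and `0 ≤ j ≤ n-1`. -/
def Ee (m n : ℕ) (A B X : ℕ → ℕ → ℤ) : ℚ :=
  (1 / 2 : ℚ) * ∑ i ∈ Finset.range m, ∑ j ∈ Finset.range n, (dA n A i j : ℚ) ^ 2 +
  (1 / 2 : ℚ) * ∑ i ∈ Finset.range m, ∑ j ∈ Finset.range n, (dB m B i j : ℚ) ^ 2 +
  ∑ i ∈ Finset.range m, ∑ j ∈ Finset.range n, ((X i j : ℚ) - (dA n A i j : ℚ)) ^ 2 +
  ∑ i ∈ Finset.range m, ∑ j ∈ Finset.range n, (X i j : ℚ) * (1 - (dB m B i j : ℚ))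

/-- Dual-permutation condition: for all `i < m` and `j < n`, if `Δa_{i,j} = 1` then
`Δb_{i,j} = 1`. -/
def DualPerm (m n : ℕ) (A B : ℕ → ℕ → ℤ) : Prop :=
  ∀ i < m, ∀ j < n, dA n A i j = 1 → dB m B i j = 1

/-- One-hot permutation condition: `x_{i,j} = Δa_{i,j}` for all `i < m`, `j < n`. -/
def OneHotPerm (m n : ℕ) (A X : ℕ → ℕ → ℤ) : Prop :=
  ∀ i < m, ∀ j < n, X i j = dA n A i j

theorem colDW_iff_rowDW_transpose (m n : ℕ) (B : ℕ → ℕ → ℤ) :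
    ColDW m n B ↔ RowDW n m (fun j i => B i j) := Iff.rfl

theorem sum_dA {n : ℕ} (hn : 1 ≤ n) (A : ℕ → ℕ → ℤ) (i : ℕ) :
    ∑ j ∈ Finset.range n, dA n A i j = 1 := by
  have h : n ≠ 0 := by omega
  simp only [dA]
  rw [Finset.sum_range_sub']
  simp [gA, h]

theorem gA_eq_zero_or_one {n : ℕ} {A : ℕ → ℕ → ℤ} {i : ℕ}
    (hA : ∀ j < n - 1, A i j = 0 ∨ A i j = 1) (j : ℕ) : gA n A i j = 0 ∨ gA n A i j = 1 := by
  unfold gA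
  split_ifs with h₀ h₁
  · exact Or.inr rfl
  · exact hA _ (by omega)
  · exact Or.inl rfl

theorem dA_cases {n : ℕ} {A : ℕ → ℕ → ℤ} {i : ℕ}
    (hA : ∀ j < n - 1, A i j = 0 ∨ A i j = 1) (j : ℕ) :
    dA n A i j = -1 ∨ dA n A i j = 0 ∨ dA n A i j = 1 := by
  have h₀ := gA_eq_zero_or_one hA j
  have h₁ := gA_eq_zero_or_one hA (j + 1)
  unfold dA
  omega

/-- A nonincreasing binary vector is a domain-wall vector. -/
theorem exists_domain_wall (c : ℕ → ℤ) (k : ℕ) (hc : ∀ j < k, c j = 0 ∨ c j = 1)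
    (hanti : ∀ j, j + 1 < k → c (j + 1) ≤ c j) :
    ∃ t ≤ k, ∀ j < k, (j < t → c j = 1) ∧ (t ≤ j → c j = 0) := by
  induction k with
  | zero => exact ⟨0, le_rfl, fun j hj => by omega⟩
  | succ k ih =>
    obtain ⟨t, ht, h⟩ := ih (fun j hj => hc j (by omega)) (fun j hj => hanti j (by omega))
    rcases hc k (by omega) with hk | hk
    · refine ⟨t, by omega, fun j hj => ?_⟩
      rcases Nat.lt_succ_iff_lt_or_eq.mp hj with hj | rfl
      · exact h j hj
      · exact ⟨fun _ => by omega, fun _ => hk⟩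
    · have htk : t = k := by
        by_contra hne
        have h₀ := (h (k - 1) (by omega)).2 (by omega)
        have h₁ := hanti (k - 1) (by omega)
        rw [Nat.sub_add_cancel (by omega)] at h₁
        omega
      refine ⟨k + 1, le_rfl, fun j hj => ⟨fun _ => ?_, fun _ => by omega⟩⟩
      rcases Nat.lt_succ_iff_lt_or_eq.mp hj with hj | rfl
      · exact (h j hj).1 (by omega)
      · exact hk

theorem rowDW_of_dA_nonneg {m n : ℕ} {A : ℕ → ℕ → ℤ}
    (hA : ∀ i < m, ∀ j < n - 1, A i j = 0 ∨ A i j = 1)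
    (h : ∀ i < m, ∀ j < n, 0 ≤ dA n A i j) : RowDW m n A := by
  intro i hi
  refine exists_domain_wall (A i) (n - 1) (hA i hi) fun j hj => ?_
  have h₁ := h i hi (j + 1) (by omega)
  have h₂ : j + 1 < n := by omega
  have h₃ : j + 1 + 1 < n := by omega
  simpa [dA, gA, h₂, h₃] using h₁

/-- The contribution of the entry `(i, j)` to the excess of the energy over `(m + n) / 2`. -/
def excess (m n : ℕ) (A B X : ℕ → ℕ → ℤ) (i j : ℕ) : ℚ :=
  ((dA n A i j : ℚ) ^ 2 - dA n A i j) / 2 + ((dB m B i j : ℚ) ^ 2 - dB m B i j) / 2 +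
    ((X i j : ℚ) - dA n A i j) ^ 2 + (X i j : ℚ) * (1 - dB m B i j)

theorem Ee_eq_add_sum_excess {m n : ℕ} (hm : 1 ≤ m) (hn : 1 ≤ n) (A B X : ℕ → ℕ → ℤ) :
    Ee m n A B X = ((m : ℚ) + n) / 2 +
      ∑ i ∈ Finset.range m, ∑ j ∈ Finset.range n, excess m n A B X i j := by
  have h₁ : ∑ i ∈ Finset.range m, ∑ j ∈ Finset.range n, (dA n A i j : ℚ) = m := by
    have h : ∀ i, ∑ j ∈ Finset.range n, (dA n A i j : ℚ) = 1 := fun i => by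
      exact_mod_cast sum_dA hn A i
    simp [h]
  have h₂ : ∑ i ∈ Finset.range m, ∑ j ∈ Finset.range n, (dB m B i j : ℚ) = n := by
    have h : ∀ j, ∑ i ∈ Finset.range m, (dB m B i j : ℚ) = 1 := fun j => by
      exact_mod_cast sum_dA hm (fun j i => B i j) j
    rw [Finset.sum_comm]
    simp [h]
  simp only [excess, Ee, Finset.sum_add_distrib, ← Finset.sum_div, Finset.sum_sub_distrib, h₁, h₂]
  ring

theorem excess_nonneg_and_eq_zero {m n : ℕ} {A B X : ℕ → ℕ → ℤ} {i j : ℕ}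
    (ha : dA n A i j = -1 ∨ dA n A i j = 0 ∨ dA n A i j = 1)
    (hb : dB m B i j = -1 ∨ dB m B i j = 0 ∨ dB m B i j = 1)
    (hx : X i j = 0 ∨ X i j = 1) :
    0 ≤ excess m n A B X i j ∧ (excess m n A B X i j = 0 →
      0 ≤ dA n A i j ∧ 0 ≤ dB m B i j ∧ (dA n A i j = 1 → dB m B i j = 1) ∧
        X i j = dA n A i j) := by
  unfold excess
  rcases ha with ha | ha | ha <;> rcases hb with hb | hb | hb <;> rcases hx with hx | hx <;>
    rw [ha, hb, hx] <;> norm_num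

/-- Lemma 2: if at least one of the row domain-wall, column domain-wall,
dual-permutation, or one-hot permutation conditions fails, then
`E_eᵐⁿ(A,B,X) > (m+n)/2`. -/
theorem Ee_gt_of_not_conditions (m n : ℕ) (hm : 1 ≤ m) (hmn : m ≤ n)
    (A B X : ℕ → ℕ → ℤ)
    (hA : ∀ i < m, ∀ j < n - 1, A i j = 0 ∨ A i j = 1)
    (hB : ∀ i < m - 1, ∀ j < n, B i j = 0 ∨ B i j = 1)
    (hX : ∀ i < m, ∀ j < n, X i j = 0 ∨ X i j = 1)
    (hcond : ¬(RowDW m n A ∧ ColDW m n B ∧ DualPerm m n A B ∧ OneHotPerm m n A X)) :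
    ((m : ℚ) + n) / 2 < Ee m n A B X := by
  have hn : 1 ≤ n := hm.trans hmn
  have hpt : ∀ i < m, ∀ j < n, _ := fun i hi j hj =>
    excess_nonneg_and_eq_zero (A := A) (B := B) (X := X) (m := m) (n := n)
      (dA_cases (hA i hi) j)
      (dA_cases (A := fun j i => B i j) (fun i hi => hB i hi j hj) i) (hX i hi j hj)
  rw [Ee_eq_add_sum_excess hm hn]
  refine lt_add_of_pos_right _ ?_
  have hrow : ∀ i ∈ Finset.range m, 0 ≤ ∑ j ∈ Finset.range n, excess m n A B X i j :=
    fun i hi => Finset.sum_nonneg fun j hj =>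
      (hpt i (Finset.mem_range.mp hi) j (Finset.mem_range.mp hj)).1
  refine lt_of_le_of_ne (Finset.sum_nonneg hrow) fun h₀ => hcond ?_
  have hz : ∀ i < m, ∀ j < n, _ := fun i hi j hj => (hpt i hi j hj).2 <|
    (Finset.sum_eq_zero_iff_of_nonneg fun j hj => (hpt i hi j (Finset.mem_range.mp hj)).1).mp
      ((Finset.sum_eq_zero_iff_of_nonneg hrow).mp h₀.symm i (Finset.mem_range.mpr hi))
      j (Finset.mem_range.mpr hj)
  refine ⟨rowDW_of_dA_nonneg hA fun i hi j hj => (hz i hi j hj).1, ?_,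
    fun i hi j hj => (hz i hi j hj).2.2.1, fun i hi j hj => (hz i hi j hj).2.2.2⟩
  rw [colDW_iff_rowDW_transpose]
  exact rowDW_of_dA_nonneg (fun j hj i hi => hB i hi j hj)
    fun j hj i hi => (hz i hi j hj).2.1
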